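/- For every game G, every K ∈ ℤ+, all S, T ∈ ℕ, and every L ∈ ℤ+: ε_{G_K}(S, T) ≤ 2^{S/L} · ( (L!/K^L) · Σ_{n_1,…,n_K ∈ ℕ, n_1+⋯+n_K = L} ∏_{k=1}^K ε_{G^{n_k}}(n_k·T)/(n_k!) )^{1/L}. -/

import Mathlib

open scoped ENNReal BigOperators

noncomputable section

/-- `{0,1}`-valued indicator of a proposition, in `ℝ≥0∞`. -/
def ind (p : Prop) : ℝ≥0∞ :=
  haveI := Classical.propDecidable p
  if p then 1 else 0

/-- Deterministic oracle algorithms making at most `T` queries, modeled as decision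
trees of depth at most `T`: a query is an element `q : Q`, the oracle's answer to `q`
has type `Ans q`, and the final output has type `O`. -/
inductive DT (Q : Type) (Ans : Q → Type) (O : Type) : ℕ → Type
  | ret {T : ℕ} (o : O) : DT Q Ans O T
  | query {T : ℕ} (q : Q) (cont : Ans q → DT Q Ans O T) : DT Q Ans O (T + 1)

/-- Run a decision tree against an oracle. -/
def DT.run {Q : Type} {Ans : Q → Type} {O : Type} :
    {T : ℕ} → DT Q Ans O T → ((q : Q) → Ans q) → O
  | _, DT.ret o, _ => o
  | _, DT.query q cont, f => DT.run (cont (f q)) f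

/-- The number of queries satisfying `p` made along the execution path on oracle `f`. -/
def DT.countP {Q : Type} {Ans : Q → Type} {O : Type} (p : Q → Prop) :
    {T : ℕ} → DT Q Ans O T → ((q : Q) → Ans q) → ℕ
  | _, DT.ret _, _ => 0
  | _, DT.query q cont, f =>
      (haveI := Classical.propDecidable (p q); if p q then 1 else 0)
        + DT.countP p (cont (f q)) f

/-- A (single-challenge) game: an oracle distribution `μ` over functions
`Fin M → Fin N`, a challenge distribution `π f` for each oracle `f`, and an
accepting outcome set `R f ch` for each oracle and challenge. -/
structure Game where
  M : ℕ
  N : ℕ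
  hM : 0 < M
  hN : 0 < N
  Ch : Type
  chFin : Fintype Ch
  Out : Type
  μ : PMF (Fin M → Fin N)
  π : (Fin M → Fin N) → PMF Ch
  R : (Fin M → Fin N) → Ch → Set Out

attribute [instance] Game.chFin

namespace Game

variable (G : Game)

/-- Winning probability of a deterministic `T`-query algorithm (taking the challenge
as classical input) for the game `G`. -/
def detWinProb {T : ℕ} (a : G.Ch → DT (Fin G.M) (fun _ => Fin G.N) G.Out T) : ℝ≥0∞ :=
  ∑' f : Fin G.M → Fin G.N, G.μ f * ∑' ch : G.Ch, G.π f ch * ind ((a ch).run f ∈ G.R f ch)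

/-- Uniform security `ε_G(T)`: the supremum, over randomized `T`-query algorithms
(probability distributions over deterministic ones), of the winning probability. -/
def unifSec (T : ℕ) : ℝ≥0∞ :=
  ⨆ A : PMF (G.Ch → DT (Fin G.M) (fun _ => Fin G.N) G.Out T),
    ∑' a, A a * G.detWinProb a

/-- Winning probability, in the salted game `G_K`, of a non-uniform algorithm:
a randomized `T`-query algorithm `A` receiving `S` bits of advice together with the
salt and challenge, and an advice function `adv` mapping the joint oracle to `S` bits.
The joint oracle consists of `K` i.i.d. copies `g 0, …, g (K-1)` of the oracle of `G`,
the salt `k` is uniform on `Fin K` and the challenge is drawn from `π (g k)`. -/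
def saltedWinProb (K S T : ℕ)
    (A : PMF ((Fin S → Bool) × Fin K × G.Ch →
      DT (Fin K × Fin G.M) (fun _ => Fin G.N) G.Out T))
    (adv : (Fin K → Fin G.M → Fin G.N) → Fin S → Bool) : ℝ≥0∞ :=
  ∑' g : Fin K → Fin G.M → Fin G.N,
    (∏ k, G.μ (g k)) *
      ((K : ℝ≥0∞)⁻¹ *
        ∑' k : Fin K, ∑' ch : G.Ch, G.π (g k) ch *
          ∑' a, A a *
            ind ((a (adv g, k, ch)).run (fun q => g q.1 q.2) ∈ G.R (g k) ch))

/-- Non-uniform security `ε_{G_K}(S,T)` of the salted game `G_K`: the supremum of the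
winning probability over all non-uniform `(S,T)`-algorithms `(A, adv)`. -/
def saltedNonunifSec (K S T : ℕ) : ℝ≥0∞ :=
  ⨆ (A : PMF ((Fin S → Bool) × Fin K × G.Ch →
      DT (Fin K × Fin G.M) (fun _ => Fin G.N) G.Out T))
    (adv : (Fin K → Fin G.M → Fin G.N) → Fin S → Bool),
    G.saltedWinProb K S T A adv

/-- The marginal probability of a challenge `ch` (for `f ∼ μ`, `ch ∼ π f`). -/
def chProb (ch : G.Ch) : ℝ≥0∞ := ∑' f : Fin G.M → Fin G.N, G.μ f * G.π f ch

/-- The oracle distribution `μ_ch` conditioned on the drawn challenge being `ch`. -/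
def condDist (ch : G.Ch) (f : Fin G.M → Fin G.N) : ℝ≥0∞ :=
  G.μ f * G.π f ch / G.chProb ch

/-- Uniform security `ε_{G_ch}(T)` of the challenge-conditioned plain game `G_ch`:
the supremum over randomized `T`-query algorithms of the probability, for
`f ∼ μ_ch`, that the output lies in `R f ch`. -/
def condSec (ch : G.Ch) (T : ℕ) : ℝ≥0∞ :=
  ⨆ A : PMF (DT (Fin G.M) (fun _ => Fin G.N) G.Out T),
    ∑' a, A a * ∑' f : Fin G.M → Fin G.N, G.condDist ch f * ind (a.run f ∈ G.R f ch)

/-- Uniform security `ε_{G^n}(T')` of the multi-challenge game `G^n`: `n` i.i.d.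
challenges are drawn from `π f` and the algorithm must answer all of them. -/
def multiSec (n T' : ℕ) : ℝ≥0∞ :=
  ⨆ A : PMF ((Fin n → G.Ch) → DT (Fin G.M) (fun _ => Fin G.N) (Fin n → G.Out) T'),
    ∑' a, A a * ∑' f : Fin G.M → Fin G.N, G.μ f *
      ∑' chs : Fin n → G.Ch,
        (∏ j, G.π f (chs j)) * ind (∀ j, (a chs).run f j ∈ G.R f (chs j))

end Game

/-- A plain game: a game without challenges. -/
structure PlainGame where
  M : ℕ
  N : ℕ
  hM : 0 < M
  hN : 0 < N
  Out : Type
  μ : PMF (Fin M → Fin N)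
  R : (Fin M → Fin N) → Set Out

namespace PlainGame

/-- Uniform security `ε_G(T)` of a plain game. -/
def unifSec (G : PlainGame) (T : ℕ) : ℝ≥0∞ :=
  ⨆ A : PMF (DT (Fin G.M) (fun _ => Fin G.N) G.Out T),
    ∑' a, A a * ∑' f : Fin G.M → Fin G.N, G.μ f * ind (a.run f ∈ G.R f)

end PlainGame

/-- Query domain for joint oracle access to the oracles of `k` plain games:
each query is addressed to one of the oracles. -/
abbrev ProdQ {k : ℕ} (Gs : Fin k → PlainGame) : Type := (i : Fin k) × Fin (Gs i).M

/-- Answer type for queries in the direct product. -/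
abbrev ProdAns {k : ℕ} (Gs : Fin k → PlainGame) : ProdQ Gs → Type :=
  fun q => Fin (Gs q.1).N

/-- The joint oracle `(f 0, …, f (k-1))` as a single oracle function. -/
def jointOracle {k : ℕ} {Gs : Fin k → PlainGame}
    (f : (i : Fin k) → Fin (Gs i).M → Fin (Gs i).N) : (q : ProdQ Gs) → ProdAns Gs q :=
  fun q => f q.1 q.2

/-- Winning probability of a `(T 0, …, T (k-1))`-memoryless algorithm, given by
deterministic algorithms `A i` (each making at most `T i` queries and each with
joint oracle access) run sequentially with no shared memory; the oracles are drawn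
independently, and the algorithm wins if every output `(A i).run` is accepted. -/
def memorylessWinProb {k : ℕ} (Gs : Fin k → PlainGame) {T : Fin k → ℕ}
    (A : (i : Fin k) → DT (ProdQ Gs) (ProdAns Gs) (Gs i).Out (T i)) : ℝ≥0∞ :=
  ∑' f : (i : Fin k) → Fin (Gs i).M → Fin (Gs i).N,
    (∏ i, (Gs i).μ (f i)) * ind (∀ i, (A i).run (jointOracle f) ∈ (Gs i).R (f i))

/-- Winning probability of a deterministic algorithm with joint oracle access
outputting a tuple `(e 0, …, e (k-1))` for the direct product game. -/
def jointWinProb {k : ℕ} (Gs : Fin k → PlainGame) {B : ℕ}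
    (A : DT (ProdQ Gs) (ProdAns Gs) ((i : Fin k) → (Gs i).Out) B) : ℝ≥0∞ :=
  ∑' f : (i : Fin k) → Fin (Gs i).M → Fin (Gs i).N,
    (∏ i, (Gs i).μ (f i)) * ind (∀ i, A.run (jointOracle f) i ∈ (Gs i).R (f i))

/-- A deterministic algorithm is `(T 0, …, T (k-1))`-fair if in every execution it
makes at most `T i` queries to the `i`-th oracle. -/
def IsFair {k : ℕ} {Gs : Fin k → PlainGame} {O : Type} {B : ℕ} (T : Fin k → ℕ)
    (A : DT (ProdQ Gs) (ProdAns Gs) O B) : Prop :=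
  ∀ (f : (i : Fin k) → Fin (Gs i).M → Fin (Gs i).N) (i : Fin k),
    A.countP (fun q => q.1 = i) (jointOracle f) ≤ T i

end

/-- Independent suprema commute with a finite sum. -/
theorem ENNReal.sum_iSup_eq_iSup_sum_pi {α : Type*} [Fintype α] {X : α → Type*}
    [∀ a, Nonempty (X a)] (F : ∀ a, X a → ℝ≥0∞) :
    ∑ a, ⨆ x, F a x = ⨆ x : ∀ a, X a, ∑ a, F a (x a) := by
  classical
  rw [← ENNReal.finsetSum_iSup (s := Finset.univ) (f := fun a (x : ∀ a, X a) => F a (x a))]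
  · refine Finset.sum_congr rfl fun a _ => ?_
    exact ((Function.surjective_eval a).iSup_comp (F a)).symm
  · intro x y
    refine ⟨fun a => if F a (x a) ≤ F a (y a) then y a else x a, fun a => ?_⟩
    dsimp only
    split_ifs with h
    · exact ⟨h, le_rfl⟩
    · exact ⟨le_rfl, (not_le.mp h).le⟩

namespace DT

variable {Q : Type} {Ans : Q → Type} {O : Type}

instance [Nonempty O] (T : ℕ) : Nonempty (DT Q Ans O T) :=
  ⟨ret (Classical.arbitrary O)⟩

theorem exists_run_eq_of_le {T : ℕ} (a : DT Q Ans O T) :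
    ∀ {T' : ℕ}, T ≤ T' → ∃ c : DT Q Ans O T', ∀ f, c.run f = a.run f := by
  induction a with
  | ret o => exact fun _ => ⟨ret o, fun _ => rfl⟩
  | query q cont ih =>
    intro T' h
    obtain ⟨t, rfl⟩ : ∃ t, T' = t + 1 := ⟨T' - 1, by omega⟩
    choose c hc using fun b => ih b (Nat.le_of_succ_le_succ h)
    exact ⟨query q c, fun f => hc _ f⟩

theorem exists_run_eq_bind {O' : Type} {T T₂ : ℕ} (a : DT Q Ans O T)
    (b : O → DT Q Ans O' T₂) :
    ∀ {T' : ℕ}, T + T₂ ≤ T' →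
      ∃ c : DT Q Ans O' T', ∀ f, c.run f = (b (a.run f)).run f := by
  induction a with
  | ret o => exact fun h => exists_run_eq_of_le (b o) (by omega)
  | query q cont ih =>
    intro T' h
    obtain ⟨t, rfl⟩ : ∃ t, T' = t + 1 := ⟨T' - 1, by omega⟩
    choose c hc using fun r => ih r (T' := t) (by omega)
    exact ⟨query q c, fun f => hc _ f⟩

/-- Decision trees can be run one after another, collecting all outputs. -/
theorem exists_run_eq_pi {T : ℕ} : ∀ (n : ℕ) (a : Fin n → DT Q Ans O T),
    ∃ c : DT Q Ans (Fin n → O) (n * T), ∀ f j, c.run f j = (a j).run f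
  | 0, _ => ⟨ret Fin.elim0, fun _ j => j.elim0⟩
  | n + 1, a => by
    obtain ⟨c, hc⟩ := exists_run_eq_pi n (fun j => a j.succ)
    choose d hd using fun o : O => exists_run_eq_bind c
      (fun os => (ret (Fin.cons o os) : DT Q Ans (Fin (n + 1) → O) 0)) le_rfl
    obtain ⟨e, he⟩ := exists_run_eq_bind (a 0) d (T' := (n + 1) * T)
      (by rw [Nat.succ_mul]; omega)
    refine ⟨e, fun f j => ?_⟩
    rw [he, hd]
    refine Fin.cases ?_ (fun j => ?_) j
    · rfl
    · exact hc f j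

end DT

section Value

variable {Q B O : Type} [Fintype Q] [DecidableEq Q] [Fintype B] [DecidableEq B]

/-- The optimal payoff, against a weighted oracle, of a `t`-query algorithm which receives
`v o f` for the output `o` on the oracle `f`. -/
noncomputable def optValue (v : O → (Q → B) → ℝ≥0∞) :
    ℕ → ((Q → B) → ℝ≥0∞) → ℝ≥0∞
  | 0, w => ⨆ o, ∑ f, w f * v o f
  | t + 1, w => optValue v t w ⊔
      ⨆ q, ∑ b, optValue v t (fun f => if f q = b then w f else 0)

variable (v : O → (Q → B) → ℝ≥0∞)

theorem optValue_mono (w : (Q → B) → ℝ≥0∞) : Monotone fun t => optValue v t w :=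
  monotone_nat_of_le_succ fun _ => le_sup_left

theorem sum_le_optValue (t : ℕ) (w : (Q → B) → ℝ≥0∞) (o : O) :
    ∑ f, w f * v o f ≤ optValue v t w :=
  (le_iSup (fun o => ∑ f, w f * v o f) o).trans (optValue_mono v w (Nat.zero_le t))

theorem sum_optValue_le (t : ℕ) (w : (Q → B) → ℝ≥0∞) (q : Q) :
    ∑ b, optValue v t (fun f => if f q = b then w f else 0) ≤ optValue v (t + 1) w :=
  (le_iSup (fun q => ∑ b, optValue v t (fun f => if f q = b then w f else 0)) q).trans
    le_sup_right

theorem optValue_zero_weight (t : ℕ) : optValue v t (fun _ => 0) = 0 := by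
  induction t with
  | zero => simp [optValue]
  | succ t ih => simp [optValue, ih]

theorem optValue_le_iSup [Nonempty O] (t : ℕ) (w : (Q → B) → ℝ≥0∞) :
    optValue v t w ≤ ⨆ a : DT Q (fun _ => B) O t, ∑ f, w f * v (a.run f) f := by
  induction t generalizing w with
  | zero => exact iSup_le fun o => le_iSup_of_le (DT.ret o) le_rfl
  | succ t ih =>
    refine sup_le ((ih w).trans <| iSup_le fun a => ?_) (iSup_le fun q => ?_)
    · obtain ⟨c, hc⟩ := DT.exists_run_eq_of_le a (Nat.le_succ t)
      exact le_iSup_of_le c (by simp [hc])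
    · refine (Finset.sum_le_sum fun b _ => ih _).trans ?_
      rw [ENNReal.sum_iSup_eq_iSup_sum_pi]
      refine iSup_le fun c => le_iSup_of_le (DT.query q c) ?_
      rw [Finset.sum_comm]
      refine Finset.sum_le_sum fun f _ => ?_
      simp [DT.run, ite_mul]

end Value

/-- A self-map of a finite type is injective on some nonempty part of any nonempty finite set `s`
which contains all its images lying in `s`. -/
theorem Finset.exists_subset_injOn_image {ι : Type*} [Finite ι] (s : Finset ι)
    (hs : s.Nonempty) (σ : ι → ι) :
    ∃ P ⊆ s, P.Nonempty ∧ Set.InjOn σ P ∧ ∀ p ∈ P, σ p ∈ s → σ p ∈ P := by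
  classical
  by_cases h : ∃ i ∈ s, σ i ∉ s
  · obtain ⟨i, hi, hσ⟩ := h
    exact ⟨{i}, by simpa using hi, by simp, by simp, by simp [hσ]⟩
  · push Not at h
    refine ⟨s.filter (· ∈ Function.periodicPts σ), Finset.filter_subset _ _, ?_, ?_, ?_⟩
    · obtain ⟨i, hi⟩ := hs
      have hit : ∀ n, σ^[n] i ∈ s := fun n => by
        induction n with
        | zero => exact hi
        | succ n ih => rw [Function.iterate_succ_apply']; exact h _ ih
      obtain ⟨m, n, hne, heq⟩ := Finite.exists_ne_map_eq_of_infinite fun n : ℕ => σ^[n] i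
      wlog hmn : m < n generalizing m n
      · exact this n m hne.symm heq.symm (by omega)
      refine ⟨σ^[m] i, Finset.mem_filter.mpr ⟨hit m, ?_⟩⟩
      refine Function.mk_mem_periodicPts (n := n - m) (by omega) ?_
      rw [Function.IsPeriodicPt, Function.IsFixedPt, ← Function.iterate_add_apply]
      rw [Nat.sub_add_cancel hmn.le]
      exact heq.symm
    · exact (Function.bijOn_periodicPts σ).injOn.mono fun x hx => (Finset.mem_filter.mp hx).2
    · intro p hp hs
      exact Finset.mem_filter.mpr
        ⟨hs, (Function.bijOn_periodicPts σ).mapsTo (Finset.mem_filter.mp hp).2⟩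

section Memoryless

variable {ι Q B : Type} [Fintype ι] [DecidableEq ι] [Fintype Q] [DecidableEq Q]
  [Fintype B] [DecidableEq B]

/-- Splitting a sum over tuples of oracles according to a label of each component. -/
theorem sum_split_labels {F : Type} [Fintype F] (ℓ : ι → F → B) (w : ι → F → ℝ≥0∞)
    (H : (ι → F) → ℝ≥0∞) :
    ∑ g : ι → F, (∏ i, w i (g i)) * H g =
      ∑ a : ι → B, ∑ g : ι → F, (∏ i, if ℓ i (g i) = a i then w i (g i) else 0) * H g := by
  rw [Finset.sum_comm]
  refine Finset.sum_congr rfl fun g _ => ?_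
  rw [Finset.sum_eq_single fun i => ℓ i (g i)]
  · simp
  · intro a _ ha
    obtain ⟨i, hi⟩ := Function.ne_iff.mp ha
    rw [Finset.prod_eq_zero (Finset.mem_univ i) (if_neg (Ne.symm hi)), zero_mul]
  · simp

/-- The total payoff of algorithms sharing no memory, each with access to all oracles, is at most
the product of the optimal payoffs of algorithms with access to their own oracle only. -/
theorem sum_prod_run_le_prod_optValue [Nonempty Q] [Nonempty B] {O : ι → Type}
    (v : ∀ i, O i → (Q → B) → ℝ≥0∞) (s : Finset ι) (w : ι → (Q → B) → ℝ≥0∞)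
    (A : ∀ i, Σ T, DT (ι × Q) (fun _ => B) (O i) T) :
    ∑ g : ι → Q → B, (∏ i, w i (g i)) *
        ∏ i ∈ s, v i ((A i).2.run fun q => g q.1 q.2) (g i) ≤
      ∏ i, if i ∈ s then optValue (v i) (A i).1 (w i) else ∑ f, w i f := by
  classical
  induction hn : ∑ i ∈ s, ((A i).1 + 1) using Nat.strong_induction_on generalizing s w A with
  | _ n IH =>
  subst hn
  rcases s.eq_empty_or_nonempty with rfl | hs
  · simp [Finset.prod_univ_sum]
  by_cases hret : ∃ i ∈ s, ∃ o, ∀ g, (A i).2.run g = o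
  · obtain ⟨i, hi, o, ho⟩ := hret
    have key := IH _ (Finset.sum_erase_lt_of_pos hi (Nat.succ_pos _)) (s.erase i)
      (Function.update w i fun f => w i f * v i o f) A rfl
    refine (le_of_eq ?_).trans (key.trans (Finset.prod_le_prod' fun j _ => ?_))
    · refine Finset.sum_congr rfl fun g _ => ?_
      rw [← Finset.mul_prod_erase s _ hi, ho, ← mul_assoc]
      congr 1
      rw [← Finset.mul_prod_erase _ _ (Finset.mem_univ i),
        ← Finset.mul_prod_erase _ (fun j => Function.update w i _ j (g j)) (Finset.mem_univ i)]
      rw [Function.update_self, mul_right_comm]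
      congr 1
      refine Finset.prod_congr rfl fun j hj => ?_
      rw [Function.update_of_ne (Finset.ne_of_mem_erase hj)]
    · rcases eq_or_ne j i with rfl | hj
      · simpa [hi] using sum_le_optValue (v j) (A j).1 (w j) o
      · simp [hj]
  have hstep : ∀ i, ∃ (q : ι × Q) (t : ℕ) (c : B → DT (ι × Q) (fun _ => B) (O i) t),
      i ∈ s → t + 1 = (A i).1 ∧ ∀ g, (A i).2.run g = (c (g q)).run g := by
    intro i
    by_cases hi : i ∈ s
    · rcases hA : A i with ⟨T, _ | ⟨q, c⟩⟩
      · exact absurd ⟨i, hi, _, fun g => by rw [hA]; rfl⟩ hret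
      · exact ⟨q, _, c, fun _ => ⟨rfl, fun _ => rfl⟩⟩
    · exact ⟨(i, Classical.arbitrary Q), _, fun _ => (A i).2, fun h => absurd h hi⟩
  choose q t c hc using hstep
  obtain ⟨P, hPs, hPne, hinj, hclosed⟩ :=
    s.exists_subset_injOn_image hs fun i => (q i).1
  have hlabel : ∀ j, ∃ ℓ : (Q → B) → B,
      (∀ p ∈ P, (q p).1 = j → ∀ f, ℓ f = f (q p).2) ∧
        ((∀ p ∈ P, (q p).1 ≠ j) → ∃ b, ∀ f, ℓ f = b) := by
    intro j
    by_cases hj : ∃ p ∈ P, (q p).1 = j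
    · obtain ⟨p, hp, hpj⟩ := hj
      refine ⟨fun f => f (q p).2, fun p' hp' hpj' f => ?_, fun h => absurd hpj (h p hp)⟩
      rw [hinj hp' hp (hpj'.trans hpj.symm)]
    · push Not at hj
      exact ⟨fun _ => Classical.arbitrary B, fun p hp h => absurd h (hj p hp),
        fun _ => ⟨_, fun _ => rfl⟩⟩
  choose ℓ hℓ hℓ' using hlabel
  let A' : (ι → B) → ∀ i, Σ T, DT (ι × Q) (fun _ => B) (O i) T := fun a i =>
    if i ∈ P then ⟨t i, c i (a (q i).1)⟩ else A i
  let T' : ι → ℕ := fun i => if i ∈ P then t i else (A i).1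
  have hT' : ∀ a i, (A' a i).1 = T' i := fun a i => by
    simp only [A', T']; split_ifs <;> rfl
  let β : ι → B → ℝ≥0∞ := fun i b =>
    if i ∈ s then optValue (v i) (T' i) (fun f => if ℓ i f = b then w i f else 0)
    else ∑ f, if ℓ i f = b then w i f else 0
  have hsize : ∀ a, ∑ i ∈ s, ((A' a i).1 + 1) < ∑ i ∈ s, ((A i).1 + 1) := by
    intro a
    obtain ⟨p, hp⟩ := hPne
    refine Finset.sum_lt_sum (fun i hi => ?_) ⟨p, hPs hp, ?_⟩
    · have := (hc i hi).1
      simp only [hT', T']; split_ifs <;> omega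
    · have := (hc p (hPs hp)).1
      simp only [hT', T', hp, if_true]; omega
  rw [sum_split_labels ℓ]
  calc _ = ∑ a : ι → B, ∑ g : ι → Q → B,
            (∏ i, if ℓ i (g i) = a i then w i (g i) else 0) *
              ∏ i ∈ s, v i ((A' a i).2.run fun q => g q.1 q.2) (g i) := by
          refine Finset.sum_congr rfl fun a _ => Finset.sum_congr rfl fun g _ => ?_
          by_cases ha : ∀ i, ℓ i (g i) = a i
          · congr 1
            refine Finset.prod_congr rfl fun i hi => ?_
            by_cases hP : i ∈ P
            · have hA' : A' a i = ⟨t i, c i (a (q i).1)⟩ := if_pos hP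
              rw [hA', (hc i hi).2, ← ha, hℓ _ i hP rfl]
            · have hA' : A' a i = A i := if_neg hP
              rw [hA']
          · push Not at ha
            obtain ⟨i, hi⟩ := ha
            rw [Finset.prod_eq_zero (Finset.mem_univ i) (if_neg hi), zero_mul, zero_mul]
    _ ≤ ∑ a : ι → B, ∏ i, β i (a i) := by
          refine Finset.sum_le_sum fun a _ => ?_
          have := IH _ (hsize a) s (fun i f => if ℓ i f = a i then w i f else 0) (A' a) rfl
          simpa only [hT'] using this
    _ = ∏ i, ∑ b, β i b := by
          rw [Finset.prod_univ_sum, Fintype.piFinset_univ]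
    _ ≤ _ := by
          refine Finset.prod_le_prod' fun i _ => ?_
          by_cases hi : i ∈ s
          · simp only [β, hi, if_true]
            by_cases htar : ∃ p ∈ P, (q p).1 = i
            · obtain ⟨p, hp, hpi⟩ := htar
              have hiP : i ∈ P := hpi ▸ hclosed p hp (hpi ▸ hi)
              simp only [hℓ i p hp hpi, T', hiP, if_true]
              rw [← (hc i hi).1]
              exact sum_optValue_le (v i) (t i) (w i) (q p).2
            · push Not at htar
              obtain ⟨b, hb⟩ := hℓ' i htar
              simp only [hb]
              rw [Finset.sum_eq_single b]
              · simp only [if_true]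
                refine optValue_mono (v i) (w i) ?_
                have := (hc i hi).1
                simp only [T']; split_ifs <;> omega
              · intro b' _ hb'
                simp only [if_neg (Ne.symm hb'), optValue_zero_weight]
              · simp
          · simp only [β, hi, if_false]
            rw [Finset.sum_comm]
            simp

end Memoryless

namespace Game

variable (G : Game)

theorem sum_iSup_le_multiSec [Nonempty G.Out] (n T' : ℕ) :
    ∑ chs : Fin n → G.Ch,
        ⨆ a : DT (Fin G.M) (fun _ => Fin G.N) (Fin n → G.Out) T',
          ∑ f, (G.μ f * ∏ j, G.π f (chs j)) * ind (∀ j, a.run f j ∈ G.R f (chs j)) ≤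
      G.multiSec n T' := by
  classical
  rw [ENNReal.sum_iSup_eq_iSup_sum_pi]
  refine iSup_le fun a => le_iSup_of_le (PMF.pure a) ?_
  rw [tsum_eq_single a fun a' ha' => by simp [PMF.pure_apply, ha'], PMF.pure_apply, if_pos rfl,
    one_mul, tsum_fintype, Finset.sum_comm]
  refine Finset.sum_le_sum fun f _ => ?_
  rw [tsum_fintype, Finset.mul_sum]
  simp only [mul_assoc, le_refl]

/-- The winning probability of a deterministic algorithm without advice, given the oracles `g` and
the salt `k`. -/
noncomputable def saltWin {K T : ℕ}
    (a : Fin K × G.Ch → DT (Fin K × Fin G.M) (fun _ => Fin G.N) G.Out T)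
    (g : Fin K → Fin G.M → Fin G.N) (k : Fin K) : ℝ≥0∞ :=
  ∑ ch : G.Ch, G.π (g k) ch * ind ((a (k, ch)).run (fun q => g q.1 q.2) ∈ G.R (g k) ch)

theorem ind_forall {n : ℕ} (p : Fin n → Prop) : ind (∀ j, p j) = ∏ j, ind (p j) := by
  classical
  by_cases h : ∀ j, p j
  · simp [ind, h]
  · have h' := h
    push Not at h'
    obtain ⟨j, hj⟩ := h'
    rw [Finset.prod_eq_zero (Finset.mem_univ j) (by simp [ind, hj])]
    simp only [ind, h, if_false]

theorem sum_prod_saltWin_pow_le {K T : ℕ}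
    (a : Fin K × G.Ch → DT (Fin K × Fin G.M) (fun _ => Fin G.N) G.Out T) [Nonempty G.Out]
    (n : Fin K → ℕ) :
    ∑ g : Fin K → Fin G.M → Fin G.N, (∏ k, G.μ (g k)) * ∏ k, G.saltWin a g k ^ n k ≤
      ∏ k, G.multiSec (n k) (n k * T) := by
  classical
  have : Nonempty (Fin G.M) := ⟨⟨0, G.hM⟩⟩
  have : Nonempty (Fin G.N) := ⟨⟨0, G.hN⟩⟩
  choose c hc using fun k (chs : Fin (n k) → G.Ch) =>
    DT.exists_run_eq_pi (n k) fun j => a (k, chs j)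
  let w : ∀ k, (Fin (n k) → G.Ch) → (Fin G.M → Fin G.N) → ℝ≥0∞ :=
    fun k chs f => G.μ f * ∏ j, G.π f (chs j)
  let v : ∀ k, (Fin (n k) → G.Ch) → (Fin (n k) → G.Out) → (Fin G.M → Fin G.N) → ℝ≥0∞ :=
    fun k chs o f => ind (∀ j, o j ∈ G.R f (chs j))
  calc _ = ∑ chs : ∀ k, Fin (n k) → G.Ch, ∑ g : Fin K → Fin G.M → Fin G.N,
            (∏ k, w k (chs k) (g k)) *
              ∏ k, v k (chs k) ((c k (chs k)).run fun q => g q.1 q.2) (g k) := by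
          rw [Finset.sum_comm]
          refine Finset.sum_congr rfl fun g _ => ?_
          simp only [saltWin, Fintype.sum_pow]
          rw [Finset.prod_univ_sum, Fintype.piFinset_univ, Finset.mul_sum]
          refine Finset.sum_congr rfl fun chs _ => ?_
          rw [← Finset.prod_mul_distrib, ← Finset.prod_mul_distrib]
          refine Finset.prod_congr rfl fun k _ => ?_
          simp only [w, v, hc, ind_forall, Finset.prod_mul_distrib, mul_assoc]
    _ ≤ ∑ chs : ∀ k, Fin (n k) → G.Ch, ∏ k, optValue (v k (chs k)) (n k * T) (w k (chs k)) := by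
          refine Finset.sum_le_sum fun chs _ => ?_
          simpa using sum_prod_run_le_prod_optValue (fun k => v k (chs k)) Finset.univ
            (fun k => w k (chs k)) fun k => ⟨n k * T, c k (chs k)⟩
    _ = ∏ k, ∑ chs : Fin (n k) → G.Ch, optValue (v k chs) (n k * T) (w k chs) := by
          rw [Finset.prod_univ_sum, Fintype.piFinset_univ]
    _ ≤ _ := by
          refine Finset.prod_le_prod' fun k _ => ?_
          exact (Finset.sum_le_sum fun chs _ => optValue_le_iSup _ _ _).trans
            (G.sum_iSup_le_multiSec (n k) (n k * T))

theorem sum_salted_pow_le {K T : ℕ}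
    (a : Fin K × G.Ch → DT (Fin K × Fin G.M) (fun _ => Fin G.N) G.Out T) [Nonempty G.Out]
    (L : ℕ) :
    ∑ g : Fin K → Fin G.M → Fin G.N,
        (∏ k, G.μ (g k)) * ((K : ℝ≥0∞)⁻¹ * ∑ k, G.saltWin a g k) ^ L ≤
      ((Nat.factorial L : ℝ≥0∞) / (K : ℝ≥0∞) ^ L) *
        ∑ nv ∈ Finset.Nat.antidiagonalTuple K L,
          ∏ k, G.multiSec (nv k) (nv k * T) / (Nat.factorial (nv k) : ℝ≥0∞) := by
  classical
  have hfac : ∀ n : ℕ, (n.factorial : ℝ≥0∞) ≠ 0 := fun n => by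
    exact_mod_cast n.factorial_ne_zero
  have hanti : (Finset.univ : Finset (Fin K)).piAntidiag L = Finset.Nat.antidiagonalTuple K L := by
    ext; simp [Finset.mem_piAntidiag, Finset.Nat.mem_antidiagonalTuple]
  have hmult : ∀ nv ∈ Finset.Nat.antidiagonalTuple K L,
      (Nat.multinomial Finset.univ nv : ℝ≥0∞) * ∏ k, G.multiSec (nv k) (nv k * T) =
        L.factorial * ∏ k, G.multiSec (nv k) (nv k * T) / ((nv k).factorial : ℝ≥0∞) := by
    intro nv hnv
    have hspec := Nat.multinomial_spec Finset.univ nv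
    rw [Finset.Nat.mem_antidiagonalTuple.mp hnv] at hspec
    rw [← hspec, Nat.cast_mul, Nat.cast_prod, mul_right_comm, ← Finset.prod_mul_distrib, mul_comm]
    congr 1
    exact Finset.prod_congr rfl fun k _ =>
      (ENNReal.mul_div_cancel (hfac _) (ENNReal.natCast_ne_top _)).symm
  calc _ = ((K : ℝ≥0∞) ^ L)⁻¹ * ∑ nv ∈ Finset.Nat.antidiagonalTuple K L,
            (Nat.multinomial Finset.univ nv : ℝ≥0∞) *
              ∑ g : Fin K → Fin G.M → Fin G.N,
                (∏ k, G.μ (g k)) * ∏ k, G.saltWin a g k ^ nv k := by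
          simp only [mul_pow, Finset.sum_pow_eq_sum_piAntidiag, hanti, ENNReal.inv_pow]
          simp only [Finset.mul_sum]
          rw [Finset.sum_comm]
          refine Finset.sum_congr rfl fun nv _ => Finset.sum_congr rfl fun g _ => ?_
          ring
    _ ≤ ((K : ℝ≥0∞) ^ L)⁻¹ * ∑ nv ∈ Finset.Nat.antidiagonalTuple K L,
            (Nat.multinomial Finset.univ nv : ℝ≥0∞) * ∏ k, G.multiSec (nv k) (nv k * T) := by
          gcongr with nv _
          exact G.sum_prod_saltWin_pow_le a nv
    _ = _ := by
          rw [Finset.sum_congr rfl hmult, ← Finset.mul_sum, div_eq_mul_inv, ← mul_assoc,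
            mul_comm (_⁻¹)]

theorem sum_prod_μ (K : ℕ) : ∑ g : Fin K → Fin G.M → Fin G.N, ∏ k, G.μ (g k) = 1 := by
  classical
  have h : ∑ f, G.μ f = 1 := by rw [← tsum_fintype (L := .unconditional _)]; exact G.μ.tsum_coe
  rw [← Fintype.piFinset_univ, ← Finset.prod_univ_sum]
  simp [h]

/-- Averaging over the internal randomness reduces to deterministic algorithms. -/
theorem saltedWinProb_le {K S T : ℕ}
    (A : PMF ((Fin S → Bool) × Fin K × G.Ch →
      DT (Fin K × Fin G.M) (fun _ => Fin G.N) G.Out T))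
    (adv : (Fin K → Fin G.M → Fin G.N) → Fin S → Bool) (C : ℝ≥0∞)
    (h : ∀ a : (Fin S → Bool) × Fin K × G.Ch →
        DT (Fin K × Fin G.M) (fun _ => Fin G.N) G.Out T,
      ∑ g : Fin K → Fin G.M → Fin G.N, (∏ k, G.μ (g k)) *
        ((K : ℝ≥0∞)⁻¹ * ∑ k, G.saltWin (fun x => a (adv g, x)) g k) ≤ C) :
    G.saltedWinProb K S T A adv ≤ C := by
  calc G.saltedWinProb K S T A adv
      = ∑' a, A a * ∑ g : Fin K → Fin G.M → Fin G.N, (∏ k, G.μ (g k)) *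
          ((K : ℝ≥0∞)⁻¹ * ∑ k, G.saltWin (fun x => a (adv g, x)) g k) := by
        simp only [saltedWinProb, saltWin, tsum_fintype, Finset.mul_sum]
        simp only [Summable.tsum_finsetSum fun _ _ => ENNReal.summable,
          ← ENNReal.tsum_mul_left]
        refine Finset.sum_congr rfl fun g _ => Finset.sum_congr rfl fun k _ =>
          Finset.sum_congr rfl fun ch _ => tsum_congr fun a => ?_
        ring
    _ ≤ ∑' a, A a * C := ENNReal.tsum_le_tsum fun a => by gcongr; exact h a
    _ = C := by rw [ENNReal.tsum_mul_right, A.tsum_coe, one_mul]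

theorem sum_advice_le {K S T : ℕ} [Nonempty G.Out] (L : ℕ) (hL : 0 < L) (D : ℝ≥0∞)
    (hD : ∀ a : Fin K × G.Ch → DT (Fin K × Fin G.M) (fun _ => Fin G.N) G.Out T,
      ∑ g : Fin K → Fin G.M → Fin G.N,
        (∏ k, G.μ (g k)) * ((K : ℝ≥0∞)⁻¹ * ∑ k, G.saltWin a g k) ^ L ≤ D)
    (adv : (Fin K → Fin G.M → Fin G.N) → Fin S → Bool)
    (a : (Fin S → Bool) × Fin K × G.Ch → DT (Fin K × Fin G.M) (fun _ => Fin G.N) G.Out T) :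
    ∑ g : Fin K → Fin G.M → Fin G.N, (∏ k, G.μ (g k)) *
        ((K : ℝ≥0∞)⁻¹ * ∑ k, G.saltWin (fun x => a (adv g, x)) g k) ≤
      (2 : ℝ≥0∞) ^ ((S : ℝ) / (L : ℝ)) * D ^ ((L : ℝ)⁻¹) := by
  classical
  have hL' : (L : ℝ) ≠ 0 := by exact_mod_cast hL.ne'
  have hpow : (∑ g : Fin K → Fin G.M → Fin G.N, (∏ k, G.μ (g k)) *
      ((K : ℝ≥0∞)⁻¹ * ∑ k, G.saltWin (fun x => a (adv g, x)) g k)) ^ (L : ℝ) ≤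
        (2 : ℝ≥0∞) ^ (S : ℝ) * D := by
    refine (ENNReal.rpow_arith_mean_le_arith_mean_rpow _ _ _ (G.sum_prod_μ K)
      (by exact_mod_cast hL)).trans ?_
    simp only [ENNReal.rpow_natCast]
    calc _ ≤ ∑ g : Fin K → Fin G.M → Fin G.N, (∏ k, G.μ (g k)) * ∑ σ : Fin S → Bool,
              ((K : ℝ≥0∞)⁻¹ * ∑ k, G.saltWin (fun x => a (σ, x)) g k) ^ L := by
            gcongr with g _
            exact Finset.single_le_sum (f := fun σ : Fin S → Bool =>
              ((K : ℝ≥0∞)⁻¹ * ∑ k, G.saltWin (fun x => a (σ, x)) g k) ^ L)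
              (fun _ _ => zero_le) (Finset.mem_univ (adv g))
      _ = ∑ σ : Fin S → Bool, ∑ g : Fin K → Fin G.M → Fin G.N, (∏ k, G.μ (g k)) *
              ((K : ℝ≥0∞)⁻¹ * ∑ k, G.saltWin (fun x => a (σ, x)) g k) ^ L := by
            simp_rw [Finset.mul_sum (s := (Finset.univ : Finset (Fin S → Bool)))]
            exact Finset.sum_comm
      _ ≤ ∑ _σ : Fin S → Bool, D := Finset.sum_le_sum fun σ _ => hD fun x => a (σ, x)
      _ = 2 ^ S * D := by simp
  have hroot := ENNReal.rpow_le_rpow hpow (inv_nonneg.mpr (Nat.cast_nonneg (α := ℝ) L))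
  rwa [ENNReal.rpow_rpow_inv hL', ENNReal.mul_rpow_of_nonneg _ _ (by positivity),
    ← ENNReal.rpow_mul, ← div_eq_mul_inv] at hroot

end Game

/-- For every game `G`, every `K ∈ ℤ+`, all `S, T ∈ ℕ` and every
`L ∈ ℤ+`,
`ε_{G_K}(S,T) ≤ 2^{S/L} · ((L!/K^L) · Σ_{n₁+⋯+n_K=L} ∏_k ε_{G^{n_k}}(n_k·T)/(n_k!))^{1/L}`. -/
theorem salted_nonuniform_le_multichallenge (G : Game) (K : ℕ) (hK : 0 < K)
    (S T : ℕ) (L : ℕ) (hL : 0 < L) :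
    G.saltedNonunifSec K S T ≤
      (2 : ℝ≥0∞) ^ ((S : ℝ) / (L : ℝ)) *
        (((Nat.factorial L : ℝ≥0∞) / (K : ℝ≥0∞) ^ L) *
            ∑ nv ∈ Finset.Nat.antidiagonalTuple K L,
              ∏ k, G.multiSec (nv k) (nv k * T) / (Nat.factorial (nv k) : ℝ≥0∞))
          ^ ((L : ℝ)⁻¹) := by
  refine iSup_le fun A => iSup_le fun adv => G.saltedWinProb_le A adv _ fun a => ?_
  have : Nonempty G.Out := by
    obtain ⟨ch, -⟩ := (G.π fun _ => ⟨0, G.hN⟩).support_nonempty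
    exact ⟨(a (fun _ => false, ⟨0, hK⟩, ch)).run fun _ => ⟨0, G.hN⟩⟩
  exact G.sum_advice_le L hL _ (fun a' => G.sum_salted_pow_le a' L) adv a
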